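/- Suppose n ≥ 3, α ∈ (0,n), λ = (n−α)/(n−2), and σ = g_α(λ) = n/(n−2). Then there does not exist a pointwise bound for nonnegative solutions of the Choquard–Pekar inequality problem as x → 0: for every continuous φ : (0,1) → (0,∞) with φ(t) → ∞ as t → 0⁺, there exists a nonnegative solution u with u(x) ≠ O(φ(|x|)) as x → 0. -/

import Mathlib

open MeasureTheory Metric Filter Set Asymptotics Topology

/-- `ℝⁿ` as a Euclidean space. -/
abbrev Euc (n : ℕ) : Type := EuclideanSpace ℝ (Fin n)

/-- The Laplacian `Δu(x) = ∑ i ∂²u/∂xᵢ²(x)`. -/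
noncomputable def lap {n : ℕ} (u : Euc n → ℝ) (x : Euc n) : ℝ :=
  ∑ i : Fin n, iteratedFDeriv ℝ 2 u x ![EuclideanSpace.single i 1, EuclideanSpace.single i 1]

/-- `u` is a nonnegative solution of the Choquard–Pekar inequality problem:
`u ∈ C²(ℝⁿ \ {0}) ∩ L^λ(ℝⁿ)` and
`0 ≤ -Δu(x) ≤ (∫ |x-y|^(-α) u(y)^λ dy) · u(x)^σ` on `B₂(0) \ {0}`. -/
def IsCPSolution (n : ℕ) (α lam sig : ℝ) (u : Euc n → ℝ) : Prop :=
  (∀ x, 0 ≤ u x) ∧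
  ContDiffOn ℝ 2 u {0}ᶜ ∧
  Integrable (fun y => u y ^ lam) ∧
  ∀ x ∈ ball (0 : Euc n) 2 \ {0},
    0 ≤ -lap u x ∧
    -lap u x ≤ (∫ y, ‖x - y‖ ^ (-α) * u y ^ lam) * u x ^ sig

/-- `u(x) ≠ O(φ(|x|))` as `x → 0`: there is a sequence `x_j → 0` with
`u(x_j)/φ(|x_j|) → ∞`. -/
def NotBigOAt (n : ℕ) (u : Euc n → ℝ) (φ : ℝ → ℝ) : Prop :=
  ∃ x : ℕ → Euc n, (∀ j, x j ≠ 0) ∧ Tendsto x atTop (𝓝 0) ∧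
    Tendsto (fun j => u (x j) / φ ‖x j‖) atTop atTop

section Calculus

variable {E : Type*} [NormedAddCommGroup E]

/-- The bubble profile `(a + |x - p|²)^s`. -/
noncomputable def bubble (s a : ℝ) (p x : E) : ℝ := (a + ‖x - p‖ ^ 2) ^ s

lemma bubble_pos {s a : ℝ} (ha : 0 < a) (p x : E) : 0 < bubble s a p x := by
  unfold bubble; positivity

lemma bubble_le {s a δ : ℝ} (hs : s ≤ 0) (hδ : 0 < δ) {p x : E} (h : δ ≤ a + ‖x - p‖ ^ 2) :
    bubble s a p x ≤ δ ^ s :=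
  Real.rpow_le_rpow_of_nonpos hδ h hs

lemma bubble_mul_norm_sq_le {s a : ℝ} (ha : 0 < a) (p x : E) :
    bubble (s - 1) a p x * ‖x - p‖ ^ 2 ≤ bubble s a p x := by
  have hq : 0 < a + ‖x - p‖ ^ 2 := by positivity
  have : bubble s a p x = bubble (s - 1) a p x * (a + ‖x - p‖ ^ 2) := by
    unfold bubble
    rw [Real.rpow_sub_one hq.ne']; field_simp
  rw [this]
  exact mul_le_mul_of_nonneg_left (by linarith) (bubble_pos ha p x).le

variable [InnerProductSpace ℝ E]

/-- The first derivative of `bubble s a p`. -/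
noncomputable def bubbleDeriv (s a : ℝ) (p x : E) : E →L[ℝ] ℝ :=
  (2 * s * bubble (s - 1) a p x) • innerSL ℝ (x - p)

/-- The real inner product as a continuous bilinear map. -/
noncomputable def innerCLM (E : Type*) [NormedAddCommGroup E] [InnerProductSpace ℝ E] :
    E →L[ℝ] E →L[ℝ] ℝ := innerSL ℝ

@[simp] lemma innerCLM_apply (v w : E) : innerCLM E v w = inner ℝ v w := rfl

/-- The second derivative of `bubble s a p`. -/
noncomputable def bubbleDeriv₂ (s a : ℝ) (p x : E) : E →L[ℝ] E →L[ℝ] ℝ :=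
  (2 * s * bubble (s - 1) a p x) • innerCLM E +
    (4 * s * (s - 1) * bubble (s - 2) a p x) •
      (innerSL ℝ (x - p)).smulRight (innerSL ℝ (x - p))

lemma hasFDerivAt_bubble {s a : ℝ} (ha : 0 < a) (p x : E) :
    HasFDerivAt (bubble s a p) (bubbleDeriv s a p x) x := by
  have h : HasFDerivAt (fun y : E => a + ‖y - p‖ ^ 2) (2 • innerSL ℝ (x - p)) x := by
    simpa using (((hasFDerivAt_id x).sub_const p).norm_sq).const_add a
  have h' := h.rpow_const (p := s) (Or.inl (by positivity))
  convert! h' using 1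
  ext v
  simp [bubbleDeriv, bubble]
  ring

lemma hasFDerivAt_bubbleDeriv {s a : ℝ} (ha : 0 < a) (p x : E) :
    HasFDerivAt (bubbleDeriv s a p) (bubbleDeriv₂ s a p x) x := by
  have h1 := (hasFDerivAt_bubble (s := s - 1) ha p x).const_mul (2 * s)
  have h2 : HasFDerivAt (fun y : E => innerSL ℝ (y - p)) (innerCLM E) x :=
    (innerCLM E).hasFDerivAt.comp x ((hasFDerivAt_id x).sub_const p)
  convert! h1.smul h2 using 1
  ext v w
  simp [bubbleDeriv₂, bubbleDeriv, show s - 1 - 1 = s - 2 by ring]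
  ring

lemma continuous_bubble {s a : ℝ} (ha : 0 < a) (p : E) : Continuous (bubble s a p) :=
  continuous_iff_continuousAt.2 fun x => (hasFDerivAt_bubble ha p x).continuousAt

lemma continuous_bubbleDeriv₂ {s a : ℝ} (ha : 0 < a) (p : E) :
    Continuous (bubbleDeriv₂ s a p) := by
  have h1 := continuous_bubble (s := s - 1) ha p
  have h2 := continuous_bubble (s := s - 2) ha p
  have h3 : Continuous fun x : E => innerSL ℝ (x - p) := by fun_prop
  have h4 : Continuous fun x : E => (innerSL ℝ (x - p)).smulRight (innerSL ℝ (x - p)) :=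
    isBoundedBilinearMap_smulRight.continuous.comp (h3.prodMk h3)
  exact ((continuous_const.mul h1).smul continuous_const).add
    ((continuous_const.mul h2).smul h4)

lemma norm_bubbleDeriv_le {s a δ : ℝ} (ha : 0 < a) (hs : s ≤ 0) (hδ : 0 < δ) {p x : E}
    (h : δ ≤ a + ‖x - p‖ ^ 2) :
    ‖bubbleDeriv s a p x‖ ≤ 2 * |s| * (δ ^ (s - 1) + δ ^ s) := by
  have h0 := (bubble_pos (s := s - 1) ha p x).le
  have h1 := bubble_le (s := s - 1) (by linarith) hδ h
  have h2 := bubble_le hs hδ h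
  have h3 := bubble_mul_norm_sq_le (s := s) ha p x
  rw [bubbleDeriv, norm_smul, innerSL_apply_norm, Real.norm_eq_abs, abs_mul, abs_mul,
    abs_of_nonneg h0, abs_of_pos (two_pos (α := ℝ)), mul_assoc (2 * |s|)]
  gcongr
  have : ‖x - p‖ ≤ 1 + ‖x - p‖ ^ 2 := by nlinarith [sq_nonneg (‖x - p‖ - 1)]
  nlinarith [mul_le_mul_of_nonneg_left this h0]

lemma norm_bubbleDeriv₂_le {s a δ : ℝ} (ha : 0 < a) (hs : s ≤ 0) (hδ : 0 < δ) {p x : E}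
    (h : δ ≤ a + ‖x - p‖ ^ 2) :
    ‖bubbleDeriv₂ s a p x‖ ≤ (2 * |s| + 4 * |s * (s - 1)|) * δ ^ (s - 1) := by
  have h0 := (bubble_pos (s := s - 1) ha p x).le
  have h0' := (bubble_pos (s := s - 2) ha p x).le
  have h1 := bubble_le (s := s - 1) (by linarith) hδ h
  have h3 := bubble_mul_norm_sq_le (s := s - 1) ha p x
  rw [show s - 1 - 1 = s - 2 by ring] at h3
  have hi : ‖innerCLM E‖ ≤ 1 := norm_innerSL_le (𝕜 := ℝ) (E := E)
  unfold bubbleDeriv₂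
  refine (ContinuousLinearMap.opNorm_add_le _ _).trans ?_
  rw [norm_smul, norm_smul, ContinuousLinearMap.norm_smulRight_apply, innerSL_apply_norm,
    add_mul]
  refine add_le_add ?_ ?_
  · rw [Real.norm_eq_abs, abs_mul, abs_mul, abs_of_nonneg h0, abs_of_pos (two_pos (α := ℝ))]
    calc _ ≤ 2 * |s| * bubble (s - 1) a p x * 1 := by gcongr
      _ ≤ _ := by rw [mul_one]; gcongr
  · rw [Real.norm_eq_abs, abs_mul, abs_of_nonneg h0', mul_assoc 4 s, abs_mul 4,
      abs_of_pos (four_pos (α := ℝ)), mul_assoc (4 * _)]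
    gcongr
    rw [← sq]; exact h3.trans h1

/-- Termwise differentiation, twice, of a series of `C²` functions. -/
lemma contDiffAt_two_tsum {f : ℕ → E → ℝ} {f' : ℕ → E → E →L[ℝ] ℝ}
    {f'' : ℕ → E → E →L[ℝ] E →L[ℝ] ℝ} {b₀ b₁ b₂ : ℕ → ℝ} {x₀ : E} {ρ : ℝ} (hρ : 0 < ρ)
    (hb₀ : Summable b₀) (hb₁ : Summable b₁) (hb₂ : Summable b₂)
    (hf : ∀ j, ∀ x ∈ ball x₀ ρ, HasFDerivAt (f j) (f' j x) x)
    (hf' : ∀ j, ∀ x ∈ ball x₀ ρ, HasFDerivAt (f' j) (f'' j x) x)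
    (hc : ∀ j, ContinuousOn (f'' j) (ball x₀ ρ))
    (h₀ : ∀ j, ∀ x ∈ ball x₀ ρ, ‖f j x‖ ≤ b₀ j) (h₁ : ∀ j, ∀ x ∈ ball x₀ ρ, ‖f' j x‖ ≤ b₁ j)
    (h₂ : ∀ j, ∀ x ∈ ball x₀ ρ, ‖f'' j x‖ ≤ b₂ j) :
    ContDiffAt ℝ 2 (fun x => ∑' j, f j x) x₀ ∧
      ∀ v w, HasSum (fun j => f'' j x₀ v w)
        (iteratedFDeriv ℝ 2 (fun x => ∑' j, f j x) x₀ ![v, w]) := by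
  have hx₀ : x₀ ∈ ball x₀ ρ := mem_ball_self hρ
  have hpre : IsPreconnected (ball x₀ ρ) := (convex_ball x₀ ρ).isPreconnected
  have A : ∀ x ∈ ball x₀ ρ, HasFDerivAt (fun x => ∑' j, f j x) (∑' j, f' j x) x := fun x hx =>
    hasFDerivAt_tsum_of_isPreconnected hb₁ isOpen_ball hpre hf h₁ hx₀
      (.of_norm_bounded hb₀ fun j => h₀ j _ hx₀) hx
  have B : ∀ x ∈ ball x₀ ρ, HasFDerivAt (fun x => ∑' j, f' j x) (∑' j, f'' j x) x := fun x hx =>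
    hasFDerivAt_tsum_of_isPreconnected hb₂ isOpen_ball hpre hf' h₂ hx₀
      (.of_norm_bounded hb₁ fun j => h₁ j _ hx₀) hx
  have C : ContinuousOn (fun x => ∑' j, f'' j x) (ball x₀ ρ) := by
    refine continuousOn_tsum (f := f'') hc hb₂ ?_
    exact h₂
  have hmem : ball x₀ ρ ∈ 𝓝 x₀ := ball_mem_nhds _ hρ
  refine ⟨?_, fun v w => ?_⟩
  · have h1 : ContDiffAt ℝ ((0 : ℕ) + 1) (fun x => ∑' j, f' j x) x₀ :=
      contDiffAt_succ_iff_hasFDerivAt.2 ⟨_, ⟨_, hmem, B⟩, contDiffAt_zero.2 ⟨_, hmem, C⟩⟩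
    have h2 : ContDiffAt ℝ ((1 : ℕ) + 1) (fun x => ∑' j, f j x) x₀ :=
      contDiffAt_succ_iff_hasFDerivAt.2 ⟨_, ⟨_, hmem, A⟩, by simpa using h1⟩
    simpa [one_add_one_eq_two] using h2
  · have hfd : fderiv ℝ (fun x => ∑' j, f j x) =ᶠ[𝓝 x₀] fun x => ∑' j, f' j x := by
      filter_upwards [hmem] with x hx using (A x hx).fderiv
    rw [iteratedFDeriv_two_apply, hfd.fderiv_eq, (B x₀ hx₀).fderiv]
    have hs : Summable fun j => f'' j x₀ :=
      Summable.of_norm_bounded (f := fun j => f'' j x₀) hb₂ fun j => h₂ j _ hx₀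
    have h1 : HasSum (fun j => f'' j x₀ v) ((∑' j, f'' j x₀) v) :=
      (ContinuousLinearMap.apply ℝ (E →L[ℝ] ℝ) v).hasSum hs.hasSum
    have h2 : HasSum (fun j => f'' j x₀ v w) ((∑' j, f'' j x₀) v w) :=
      (ContinuousLinearMap.apply ℝ ℝ w).hasSum h1
    exact h2

end Calculus

lemma sum_bubbleDeriv₂_single {n : ℕ} {a : ℝ} (ha : 0 < a) (p x : Euc n) :
    ∑ i : Fin n, bubbleDeriv₂ ((2 - n : ℝ) / 2) a p x (EuclideanSpace.single i 1)
      (EuclideanSpace.single i 1) =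
    -(n * (n - 2) * (a / (a + ‖x - p‖ ^ 2)) * bubble (-(n : ℝ) / 2) a p x) := by
  have hq : 0 < a + ‖x - p‖ ^ 2 := by positivity
  have hn : ∑ i : Fin n, (x i - p i) * (x i - p i) = ‖x - p‖ ^ 2 := by
    rw [EuclideanSpace.norm_sq_eq]
    exact Finset.sum_congr rfl fun i _ => by simp [sq]
  have e1 : bubble ((2 - n : ℝ) / 2 - 1) a p x = bubble (-(n : ℝ) / 2) a p x := by
    congr 1; ring
  have e2 : bubble ((2 - n : ℝ) / 2 - 2) a p x =
      bubble (-(n : ℝ) / 2) a p x / (a + ‖x - p‖ ^ 2) := by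
    unfold bubble
    rw [← Real.rpow_sub_one hq.ne']; congr 1; ring
  have ht (i : Fin n) : bubbleDeriv₂ ((2 - n : ℝ) / 2) a p x (EuclideanSpace.single i 1)
      (EuclideanSpace.single i 1) =
      (2 - n) * bubble (-(n : ℝ) / 2) a p x + (2 - n) * (-n) *
        (bubble (-(n : ℝ) / 2) a p x / (a + ‖x - p‖ ^ 2)) * ((x i - p i) * (x i - p i)) := by
    rw [bubbleDeriv₂, e1, e2]
    simp [EuclideanSpace.inner_single_right]
    ring
  simp only [ht, Finset.sum_add_distrib, ← Finset.mul_sum, hn]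
  simp only [Finset.sum_const, Finset.card_univ, Fintype.card_fin, nsmul_eq_mul]
  field_simp
  ring

section Potential

variable {n : ℕ}

lemma integral_annulus_rpow (hn : 1 ≤ n) {ρ : ℝ} (hρ : 0 < ρ) (hρ1 : ρ ≤ 1) :
    ∫ z : Euc n, (Ioo ρ 1).indicator (fun t => t ^ (-(n : ℝ))) ‖z‖ =
      n * volume.real (ball (0 : Euc n) 1) * Real.log (1 / ρ) := by
  have : Nonempty (Fin n) := ⟨⟨0, hn⟩⟩
  rw [integral_fun_norm_addHaar]
  have h : ∫ y in Ioi (0 : ℝ), y ^ (Module.finrank ℝ (Euc n) - 1) •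
      (Ioo ρ 1).indicator (fun t => t ^ (-(n : ℝ))) y = Real.log (1 / ρ) := by
    have : ∀ y ∈ Ioi (0 : ℝ), y ^ (Module.finrank ℝ (Euc n) - 1) •
        (Ioo ρ 1).indicator (fun t => t ^ (-(n : ℝ))) y =
          (Ioo ρ 1).indicator (fun t => 1 / t) y := by
      intro y (hy : 0 < y)
      by_cases hm : y ∈ Ioo ρ 1
      · rw [indicator_of_mem hm, indicator_of_mem hm, finrank_euclideanSpace_fin, smul_eq_mul,
          Real.rpow_neg hy.le, Real.rpow_natCast]
        obtain ⟨k, rfl⟩ : ∃ k, n = k + 1 := ⟨n - 1, by omega⟩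
        simp only [Nat.add_sub_cancel]
        field_simp
        rw [pow_succ]
      · simp [indicator_of_notMem hm]
    rw [setIntegral_congr_fun measurableSet_Ioi this, setIntegral_indicator measurableSet_Ioo,
      show Ioi 0 ∩ Ioo ρ 1 = Ioo ρ 1 from inter_eq_right.2 fun y hy => hρ.trans hy.1,
      ← integral_Ioc_eq_integral_Ioo,
      ← intervalIntegral.integral_of_le hρ1, integral_one_div_of_pos hρ one_pos]
  rw [h, finrank_euclideanSpace_fin, nsmul_eq_mul, smul_eq_mul, mul_assoc]

lemma le_integral_riesz (hn : 1 ≤ n) {α ρ A : ℝ} (hρ : 0 < ρ) (hρ1 : ρ ≤ 1) (hA : 0 ≤ A)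
    {v : Euc n → ℝ} (hv : ∀ y, 0 ≤ v y) {x : Euc n}
    (hint : Integrable fun y => ‖x - y‖ ^ (-α) * v y)
    (hle : ∀ᵐ y, ρ < ‖x - y‖ → ‖x - y‖ < 1 → A * ‖x - y‖ ^ (-(n - α)) ≤ v y) :
    A * (n * volume.real (ball (0 : Euc n) 1) * Real.log (1 / ρ)) ≤
      ∫ y, ‖x - y‖ ^ (-α) * v y := by
  rw [← integral_annulus_rpow hn hρ hρ1, ← integral_sub_left_eq_self _ volume x,
    ← integral_const_mul]
  refine integral_mono_of_nonneg (Eventually.of_forall fun y => ?_) hint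
    (hle.mono fun y hy => ?_)
  · exact mul_nonneg hA (indicator_nonneg (fun t ht => Real.rpow_nonneg (hρ.trans ht.1).le _) _)
  · dsimp only
    by_cases hm : ‖x - y‖ ∈ Ioo ρ 1
    · have hpos : 0 < ‖x - y‖ := hρ.trans hm.1
      rw [indicator_of_mem hm]
      calc A * ‖x - y‖ ^ (-(n : ℝ)) = ‖x - y‖ ^ (-α) * (A * ‖x - y‖ ^ (-(n - α))) := by
            rw [mul_left_comm, ← Real.rpow_add hpos]; congr 2; ring
        _ ≤ _ := mul_le_mul_of_nonneg_left (hy hm.1 hm.2) (by positivity)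
    · rw [indicator_of_notMem hm, mul_zero]
      exact mul_nonneg (by positivity) (hv y)

lemma integrableOn_ball_rpow_norm (hn : 1 ≤ n) {β : ℝ} (hβ : β < n) (R : ℝ) :
    IntegrableOn (fun z : Euc n => ‖z‖ ^ (-β)) (ball 0 R) := by
  refine integrableOn_ball_of_norm_le_rpow (C := 1) (α := β) (by simpa using hn)
    (by simpa using hβ) (Eventually.of_forall fun z => ?_) ?_
  · rw [one_mul, Real.norm_of_nonneg (by positivity)]
  · exact (measurable_norm.pow_const _).aestronglyMeasurable

lemma integrable_riesz (hn : 1 ≤ n) {α : ℝ} (hα0 : 0 < α) (hαn : α < n) {v : Euc n → ℝ}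
    (hv : ∀ y, 0 ≤ v y) (hint : Integrable v) {x : Euc n} (hx : ContinuousAt v x) :
    Integrable fun y => ‖x - y‖ ^ (-α) * v y := by
  obtain ⟨ρ, hρ, hM⟩ := Metric.eventually_nhds_iff.1
    (hx.eventually (gt_mem_nhds (lt_add_one (v x))))
  have h1 : Integrable fun y => (ball (0 : Euc n) ρ).indicator (fun z => ‖z‖ ^ (-α)) (x - y) :=
    ((integrableOn_ball_rpow_norm hn hαn ρ).integrable_indicator measurableSet_ball).comp_sub_left x
  refine ((h1.const_mul (v x + 1)).add (hint.const_mul (ρ ^ (-α)))).mono' ?_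
    (Eventually.of_forall fun y => ?_)
  · exact (((measurable_const.sub measurable_id).norm.pow_const
      (-α)).aestronglyMeasurable).mul hint.aestronglyMeasurable
  · have hvx := hv x
    have hvy := hv y
    rw [Real.norm_of_nonneg (by positivity)]
    simp only [Pi.add_apply]
    by_cases hy : x - y ∈ ball (0 : Euc n) ρ
    · rw [indicator_of_mem hy, mul_comm]
      have : v y < v x + 1 := hM (by rw [dist_comm, dist_eq_norm]; simpa using hy)
      have h2 : v y * ‖x - y‖ ^ (-α) ≤ (v x + 1) * ‖x - y‖ ^ (-α) := by gcongr
      have : 0 ≤ ρ ^ (-α) * v y := by positivity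
      linarith
    · rw [indicator_of_notMem hy, mul_zero, zero_add]
      exact mul_le_mul_of_nonneg_right
        (Real.rpow_le_rpow_of_nonpos hρ (by simpa using hy) (neg_nonpos.2 hα0.le)) hvy

end Potential

section Series

lemma ofReal_tsum_rpow_le {a : ℕ → ℝ} (ha : ∀ j, 0 ≤ a j) {lam : ℝ} (hlam : 0 < lam) :
    ENNReal.ofReal ((∑' j, (1 / 4 : ℝ) ^ j * a j) ^ lam) ≤
      ENNReal.ofReal (2 ^ lam) * ∑' j, ENNReal.ofReal (((1 / 2 : ℝ) ^ j * a j) ^ lam) := by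
  set T := ∑' j, ENNReal.ofReal (((1 / 2 : ℝ) ^ j * a j) ^ lam) with hT
  have h2 : (0 : ℝ) < 2 ^ lam := by positivity
  rcases eq_or_ne T ⊤ with h | h
  · rw [h, ENNReal.mul_top (by simpa using h2)]; exact le_top
  have hj (j : ℕ) : (1 / 4 : ℝ) ^ j * a j ≤ (1 / 2 : ℝ) ^ j * T.toReal ^ (1 / lam) := by
    have h0 : 0 ≤ (1 / 2 : ℝ) ^ j * a j := mul_nonneg (by positivity) (ha j)
    have h1 : ((1 / 2 : ℝ) ^ j * a j) ^ lam ≤ T.toReal :=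
      (ENNReal.ofReal_le_iff_le_toReal h).1 (ENNReal.le_tsum j)
    have h3 : (1 / 2 : ℝ) ^ j * a j ≤ T.toReal ^ (1 / lam) := by
      have := Real.rpow_le_rpow (by positivity) h1 (by positivity : 0 ≤ 1 / lam)
      rwa [← Real.rpow_mul h0, mul_one_div_cancel hlam.ne', Real.rpow_one] at this
    calc (1 / 4 : ℝ) ^ j * a j = (1 / 2 : ℝ) ^ j * ((1 / 2 : ℝ) ^ j * a j) := by
          rw [← mul_assoc, ← mul_pow]; norm_num
      _ ≤ _ := by gcongr
  have hg : Summable fun j : ℕ => (1 / 2 : ℝ) ^ j * T.toReal ^ (1 / lam) :=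
    summable_geometric_two.mul_right _
  have h4 (j : ℕ) : 0 ≤ (1 / 4 : ℝ) ^ j * a j := mul_nonneg (by positivity) (ha j)
  have hF : ∑' j, (1 / 4 : ℝ) ^ j * a j ≤ 2 * T.toReal ^ (1 / lam) := by
    rw [← tsum_geometric_two, ← tsum_mul_right]
    exact Summable.tsum_le_tsum hj (hg.of_nonneg_of_le h4 hj) hg
  calc _ ≤ ENNReal.ofReal ((2 * T.toReal ^ (1 / lam)) ^ lam) :=
        ENNReal.ofReal_le_ofReal (Real.rpow_le_rpow (tsum_nonneg h4) hF hlam.le)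
    _ = _ := by
      rw [Real.mul_rpow zero_le_two (by positivity), ← Real.rpow_mul ENNReal.toReal_nonneg,
        one_div_mul_cancel hlam.ne', Real.rpow_one, ENNReal.ofReal_mul h2.le,
        ENNReal.ofReal_toReal h]

/-- Superadditivity of `t ↦ t^σ`, `σ ≥ 1`, along a series. -/
lemma summable_rpow_and_tsum_rpow_le {a : ℕ → ℝ} (ha : ∀ j, 0 ≤ a j) (hs : Summable a) {σ : ℝ}
    (hσ : 1 ≤ σ) : Summable (fun j => a j ^ σ) ∧ ∑' j, a j ^ σ ≤ (∑' j, a j) ^ σ := by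
  have hS : 0 ≤ ∑' j, a j := tsum_nonneg ha
  have key (t : ℝ) (ht : 0 ≤ t) : t ^ σ = t * t ^ (σ - 1) := by
    nth_rw 2 [← Real.rpow_one t]
    rw [← Real.rpow_add_of_nonneg ht zero_le_one (by linarith)]; congr 1; ring
  have hj (j : ℕ) : a j ^ σ ≤ a j * (∑' j, a j) ^ (σ - 1) := by
    rw [key _ (ha j)]
    exact mul_le_mul_of_nonneg_left (Real.rpow_le_rpow (ha j)
      (hs.le_tsum j fun i _ => ha i) (by linarith)) (ha j)
  have h1 : Summable fun j => a j * (∑' j, a j) ^ (σ - 1) := hs.mul_right _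
  have h2 : Summable fun j => a j ^ σ := h1.of_nonneg_of_le (fun j => Real.rpow_nonneg (ha j) _) hj
  exact ⟨h2, (h2.tsum_le_tsum hj h1).trans_eq (by rw [tsum_mul_right, ← key _ hS])⟩

end Series

section BubbleSeries

variable {n : ℕ} {r : ℕ → ℝ} {p : ℕ → Euc n}

/-- A superposition of fundamental-solution-like bubbles at the points `p j` and scales `r j`. -/
noncomputable def bubbleSeries (r : ℕ → ℝ) (p : ℕ → Euc n) (x : Euc n) : ℝ :=
  ∑' j, (1 / 4 : ℝ) ^ j * bubble ((2 - n : ℝ) / 2) (r j ^ 2) (p j) x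

lemma summable_one_fourth_pow : Summable fun j : ℕ => (1 / 4 : ℝ) ^ j :=
  summable_geometric_of_lt_one (by norm_num) (by norm_num)

lemma bubbleSeries_nonneg (hr : ∀ j, 0 < r j) (x : Euc n) : 0 ≤ bubbleSeries r p x :=
  tsum_nonneg fun j => mul_nonneg (by positivity) (bubble_pos (pow_pos (hr j) 2) _ _).le

lemma mul_bubble_rpow {ε s a t : ℝ} (hε : 0 < ε) (ha : 0 < a) (q x : Euc n) :
    (ε * bubble s a q x) ^ t = ε ^ t * bubble (s * t) a q x := by
  rw [Real.mul_rpow hε.le (bubble_pos ha q x).le]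
  unfold bubble
  rw [Real.rpow_mul (by positivity)]

lemma exists_lower_bound (hr : ∀ j, 0 < r j) (hp : Tendsto p atTop (𝓝 0)) {x₀ : Euc n}
    (hx₀ : x₀ ≠ 0) :
    ∃ δ > 0, ∀ j, ∀ x ∈ ball x₀ (‖x₀‖ / 2), δ ≤ r j ^ 2 + ‖x - p j‖ ^ 2 := by
  have hpos : 0 < ‖x₀‖ := norm_pos_iff.2 hx₀
  obtain ⟨N, hN⟩ := eventually_atTop.1
    (hp.eventually (ball_mem_nhds 0 (by positivity : 0 < ‖x₀‖ / 4)))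
  obtain ⟨δ, hδ, hδN⟩ : ∃ δ > 0, ∀ j < N, δ ≤ r j ^ 2 := by
    clear hN
    induction N with
    | zero => exact ⟨1, one_pos, by simp⟩
    | succ k ih =>
      obtain ⟨δ, hδ, hk⟩ := ih
      refine ⟨min δ (r k ^ 2), lt_min hδ (pow_pos (hr k) 2), fun j hj => ?_⟩
      rcases Nat.lt_succ_iff_lt_or_eq.1 hj with h | rfl
      · exact (min_le_left _ _).trans (hk j h)
      · exact min_le_right _ _
  refine ⟨min δ ((‖x₀‖ / 4) ^ 2), by positivity, fun j x hx => ?_⟩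
  rcases lt_or_ge j N with hj | hj
  · exact (min_le_left _ _).trans ((hδN j hj).trans (by simp))
  · refine (min_le_right _ _).trans ?_
    have h1 : ‖p j‖ < ‖x₀‖ / 4 := by simpa using hN j hj
    have h2 : ‖x - x₀‖ < ‖x₀‖ / 2 := by simpa [dist_eq_norm] using hx
    have h3 : ‖x₀‖ ≤ ‖x - p j‖ + ‖x - x₀‖ + ‖p j‖ := by
      calc ‖x₀‖ = ‖(x - p j) - (x - x₀) + p j‖ := by congr 1; abel
        _ ≤ _ := (norm_add_le _ _).trans (by gcongr; exact norm_sub_le _ _)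
    have h4 : ‖x₀‖ / 4 ≤ ‖x - p j‖ := by linarith
    have h5 : (‖x₀‖ / 4) ^ 2 ≤ ‖x - p j‖ ^ 2 := by gcongr
    nlinarith [sq_nonneg (r j)]

lemma summable_bubbleSeries (hn : 2 ≤ n) (hr : ∀ j, 0 < r j) (hp : Tendsto p atTop (𝓝 0))
    {x : Euc n} (hx : x ≠ 0) :
    Summable fun j => (1 / 4 : ℝ) ^ j * bubble ((2 - n : ℝ) / 2) (r j ^ 2) (p j) x := by
  have hn' : (2 : ℝ) ≤ n := by exact_mod_cast hn
  obtain ⟨δ, hδ, h⟩ := exists_lower_bound hr hp hx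
  refine (summable_one_fourth_pow.mul_right (δ ^ ((2 - n : ℝ) / 2))).of_nonneg_of_le
    (fun j => mul_nonneg (by positivity) (bubble_pos (pow_pos (hr j) 2) _ _).le) fun j => ?_
  gcongr
  exact bubble_le (by linarith) hδ (h j x (mem_ball_self (by positivity)))

lemma le_bubbleSeries (hn : 2 ≤ n) (hr : ∀ j, 0 < r j) (hp : Tendsto p atTop (𝓝 0))
    {x : Euc n} (hx : x ≠ 0) (j : ℕ) :
    (1 / 4 : ℝ) ^ j * bubble ((2 - n : ℝ) / 2) (r j ^ 2) (p j) x ≤ bubbleSeries r p x :=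
  (summable_bubbleSeries hn hr hp hx).le_tsum j fun i _ =>
    mul_nonneg (by positivity) (bubble_pos (pow_pos (hr i) 2) _ _).le

lemma contDiffAt_bubbleSeries (hn : 2 ≤ n) (hr : ∀ j, 0 < r j) (hp : Tendsto p atTop (𝓝 0))
    {x₀ : Euc n} (hx₀ : x₀ ≠ 0) :
    ContDiffAt ℝ 2 (bubbleSeries r p) x₀ ∧
      HasSum (fun j => (1 / 4 : ℝ) ^ j * (n * (n - 2) *
        (r j ^ 2 / (r j ^ 2 + ‖x₀ - p j‖ ^ 2)) * bubble (-(n : ℝ) / 2) (r j ^ 2) (p j) x₀))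
        (-lap (bubbleSeries r p) x₀) := by
  have hn' : (2 : ℝ) ≤ n := by exact_mod_cast hn
  set s : ℝ := (2 - n : ℝ) / 2 with hs
  have hs0 : s ≤ 0 := by rw [hs]; linarith
  have hr2 (j : ℕ) : 0 < r j ^ 2 := pow_pos (hr j) 2
  have hε (j : ℕ) : ‖(1 / 4 : ℝ) ^ j‖ = (1 / 4 : ℝ) ^ j := Real.norm_of_nonneg (by positivity)
  obtain ⟨δ, hδ, h⟩ := exists_lower_bound hr hp hx₀
  obtain ⟨h1, h2⟩ := contDiffAt_two_tsum
    (f := fun j x => (1 / 4 : ℝ) ^ j * bubble s (r j ^ 2) (p j) x)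
    (f' := fun j x => (1 / 4 : ℝ) ^ j • bubbleDeriv s (r j ^ 2) (p j) x)
    (f'' := fun j x => (1 / 4 : ℝ) ^ j • bubbleDeriv₂ s (r j ^ 2) (p j) x)
    (by positivity : 0 < ‖x₀‖ / 2)
    (summable_one_fourth_pow.mul_right (δ ^ s))
    (summable_one_fourth_pow.mul_right (2 * |s| * (δ ^ (s - 1) + δ ^ s)))
    (summable_one_fourth_pow.mul_right ((2 * |s| + 4 * |s * (s - 1)|) * δ ^ (s - 1)))
    (fun j x _ => (hasFDerivAt_bubble (hr2 j) (p j) x).const_mul _)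
    (fun j x _ => (hasFDerivAt_bubbleDeriv (hr2 j) (p j) x).fun_const_smul _)
    (fun j => ContinuousOn.fun_const_smul (continuous_bubbleDeriv₂ (hr2 j) (p j)).continuousOn _)
    (fun j x hx => by
      rw [norm_mul, hε, Real.norm_of_nonneg (bubble_pos (hr2 j) _ _).le]
      gcongr
      exact bubble_le hs0 hδ (h j x hx))
    (fun j x hx => by
      rw [norm_smul, hε]
      gcongr
      exact norm_bubbleDeriv_le (hr2 j) hs0 hδ (h j x hx))
    (fun j x hx => by
      refine (ContinuousLinearMap.opNorm_smul_le _ _).trans ?_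
      rw [hε]
      gcongr
      exact norm_bubbleDeriv₂_le (hr2 j) hs0 hδ (h j x hx))
  refine ⟨h1, ?_⟩
  have h3 := (hasSum_sum (s := Finset.univ) fun (i : Fin n) _ =>
    h2 (EuclideanSpace.single i (1 : ℝ)) (EuclideanSpace.single i 1)).neg
  convert! h3 using 1
  ext j
  have := sum_bubbleDeriv₂_single (hr2 j) (p j) x₀
  rw [← hs] at this
  simp only [smul_apply, smul_eq_mul, ← Finset.mul_sum, this]
  ring

lemma aestronglyMeasurable_bubbleSeries (hn : 2 ≤ n) (hr : ∀ j, 0 < r j)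
    (hp : Tendsto p atTop (𝓝 0)) : AEStronglyMeasurable (bubbleSeries r p) := by
  have : Nonempty (Fin n) := ⟨⟨0, by omega⟩⟩
  have h : ContinuousOn (bubbleSeries r p) {0}ᶜ := fun x hx =>
    (contDiffAt_bubbleSeries hn hr hp hx).1.continuousAt.continuousWithinAt
  have h' := h.aestronglyMeasurable (μ := volume) (measurableSet_singleton (0 : Euc n)).compl
  rwa [restrict_compl_singleton] at h'

lemma lintegral_ball_bubble_le {β a R : ℝ} (hβ : 0 ≤ β) (ha : 0 < a) {q : Euc n} (hn : 1 ≤ n)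
    (hq : ‖q‖ ≤ 1) :
    ∫⁻ y in ball (0 : Euc n) R, ENNReal.ofReal (bubble (-β / 2) a q y) ≤
      ∫⁻ z in ball (0 : Euc n) (R + 1), ENNReal.ofReal (‖z‖ ^ (-β)) := by
  have : Nonempty (Fin n) := ⟨⟨0, hn⟩⟩
  rw [← lintegral_indicator measurableSet_ball, ← lintegral_indicator measurableSet_ball,
    ← lintegral_sub_right_eq_self ((ball 0 (R + 1)).indicator _) q]
  refine lintegral_mono_ae ?_
  filter_upwards [compl_mem_ae_iff.2 (measure_singleton q)] with y hy
  by_cases hm : y ∈ ball (0 : Euc n) R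
  · have hm' : y - q ∈ ball (0 : Euc n) (R + 1) := by
      rw [mem_ball_zero_iff] at hm ⊢
      linarith [norm_sub_le y q]
    rw [indicator_of_mem hm, indicator_of_mem hm']
    refine ENNReal.ofReal_le_ofReal ?_
    have hpos : 0 < ‖y - q‖ := norm_pos_iff.2 (sub_ne_zero.2 hy)
    refine (bubble_le (δ := ‖y - q‖ ^ 2) (by linarith) (by positivity) (by linarith)).trans_eq ?_
    rw [← Real.rpow_natCast_mul hpos.le]
    congr 1; push_cast; ring
  · rw [indicator_of_notMem hm]; exact zero_le

lemma integrableOn_bubbleSeries_rpow (hn : 3 ≤ n) (hr : ∀ j, 0 < r j)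
    (hp : Tendsto p atTop (𝓝 0)) (hp1 : ∀ j, ‖p j‖ ≤ 1) {β lam : ℝ} (hβ0 : 0 < β) (hβ : β < n)
    (hlam : lam = β / (n - 2)) (R : ℝ) :
    IntegrableOn (fun y => bubbleSeries r p y ^ lam) (ball 0 R) := by
  have hn' : (3 : ℝ) ≤ n := by exact_mod_cast hn
  have hlam0 : 0 < lam := by rw [hlam]; exact div_pos hβ0 (by linarith)
  have hr2 (j : ℕ) : 0 < r j ^ 2 := pow_pos (hr j) 2
  refine ⟨((aestronglyMeasurable_bubbleSeries (by omega) hr hp).aemeasurable.pow_const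
    _).aestronglyMeasurable.restrict, ?_⟩
  rw [hasFiniteIntegral_iff_ofReal
    (Eventually.of_forall fun y => Real.rpow_nonneg (bubbleSeries_nonneg hr y) _)]
  set K := ∫⁻ z in ball (0 : Euc n) (R + 1), ENNReal.ofReal (‖z‖ ^ (-β)) with hK
  have hKtop : K < ⊤ := by
    have := (integrableOn_ball_rpow_norm (n := n) (by omega) hβ (R + 1)).2
    rwa [hasFiniteIntegral_iff_ofReal
      (Eventually.of_forall fun y => by positivity)] at this
  have hterm (j : ℕ) (y : Euc n) :
      ((1 / 2 : ℝ) ^ j * bubble ((2 - n : ℝ) / 2) (r j ^ 2) (p j) y) ^ lam =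
        ((1 / 2 : ℝ) ^ lam) ^ j * bubble (-β / 2) (r j ^ 2) (p j) y := by
    rw [mul_bubble_rpow (by positivity) (hr2 j), ← Real.rpow_natCast_mul (by norm_num),
      ← Real.rpow_mul_natCast (by norm_num), mul_comm lam]
    congr 2
    rw [hlam]
    have : (n : ℝ) - 2 ≠ 0 := by linarith
    field_simp
    ring
  have hmeas (j : ℕ) : Measurable fun y =>
      ENNReal.ofReal (((1 / 2 : ℝ) ^ lam) ^ j * bubble (-β / 2) (r j ^ 2) (p j) y) :=
    ((continuous_bubble (hr2 j) (p j)).measurable.const_mul _).ennreal_ofReal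
  calc ∫⁻ y in ball (0 : Euc n) R, ENNReal.ofReal (bubbleSeries r p y ^ lam)
      ≤ ∫⁻ y in ball (0 : Euc n) R, ENNReal.ofReal (2 ^ lam) * ∑' j, ENNReal.ofReal
          (((1 / 2 : ℝ) ^ lam) ^ j * bubble (-β / 2) (r j ^ 2) (p j) y) := by
        refine lintegral_mono fun y => ?_
        simp_rw [← hterm]
        exact ofReal_tsum_rpow_le (fun j => (bubble_pos (hr2 j) _ _).le) hlam0
    _ = ENNReal.ofReal (2 ^ lam) * ∑' j, ENNReal.ofReal (((1 / 2 : ℝ) ^ lam) ^ j) *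
          ∫⁻ y in ball (0 : Euc n) R, ENNReal.ofReal (bubble (-β / 2) (r j ^ 2) (p j) y) := by
        rw [lintegral_const_mul _ (Measurable.tsum hmeas),
          lintegral_tsum fun j => (hmeas j).aemeasurable]
        congr 2; ext j
        rw [← lintegral_const_mul _ (continuous_bubble (hr2 j) (p j)).measurable.ennreal_ofReal]
        congr 1; ext y
        rw [ENNReal.ofReal_mul (by positivity)]
    _ ≤ ENNReal.ofReal (2 ^ lam) * ∑' j, ENNReal.ofReal (((1 / 2 : ℝ) ^ lam) ^ j) * K := by
        gcongr with j
        exact lintegral_ball_bubble_le hβ0.le (hr2 j) (by omega) (hp1 j)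
    _ < ⊤ := by
        rw [ENNReal.tsum_mul_right, ← ENNReal.ofReal_tsum_of_nonneg (fun j => by positivity)
          (summable_geometric_of_lt_one (by positivity)
            (Real.rpow_lt_one (by norm_num) (by norm_num) hlam0))]
        exact ENNReal.mul_lt_top ENNReal.ofReal_lt_top
          (ENNReal.mul_lt_top ENNReal.ofReal_lt_top hKtop)

end BubbleSeries

section Construction

lemma exists_scale {s ε A B : ℝ} (M K : ℝ) (hs : s < 0) (hε : 0 < ε) (hA : 0 < A) (hB : 0 < B) :
    ∃ r, 0 < r ∧ r ≤ 1 ∧ M ≤ ε * (r ^ 2) ^ s ∧ K ≤ A * Real.log (1 / √r) ∧ K * r ≤ B := by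
  have h1 : ∀ᶠ r : ℝ in 𝓝[>] 0, M ≤ ε * (r ^ 2) ^ s := by
    have : Tendsto (fun r : ℝ => ε * r ^ (2 * s)) (𝓝[>] 0) atTop :=
      (tendsto_rpow_neg_nhdsGT_zero (by linarith)).const_mul_atTop hε
    filter_upwards [this.eventually_ge_atTop M, self_mem_nhdsWithin] with r hr hr0
    rwa [Real.rpow_mul (le_of_lt hr0), Real.rpow_two] at hr
  have h2 : ∀ᶠ r : ℝ in 𝓝[>] 0, K ≤ A * Real.log (1 / √r) := by
    have : Tendsto (fun r : ℝ => -(A / 2) * Real.log r) (𝓝[>] 0) atTop :=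
      Real.tendsto_log_nhdsGT_zero.const_mul_atBot_of_neg (by linarith)
    filter_upwards [this.eventually_ge_atTop K, self_mem_nhdsWithin] with r hr hr0
    rw [one_div, Real.log_inv, Real.log_sqrt (le_of_lt hr0)]
    linarith
  have h3 : ∀ᶠ r : ℝ in 𝓝[>] 0, K * r < B := by
    have : Tendsto (fun r : ℝ => K * r) (𝓝[>] 0) (𝓝 (K * 0)) :=
      (continuous_const.mul continuous_id).continuousAt.tendsto.mono_left nhdsWithin_le_nhds
    exact this.eventually (gt_mem_nhds (by simpa using hB))
  obtain ⟨r, h1, h2, h3, h4⟩ :=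
    (h1.and (h2.and (h3.and (Ioc_mem_nhdsGT (zero_lt_one' ℝ))))).exists
  exact ⟨r, h4.1, h4.2, h1, h2, h3.le⟩

variable {n : ℕ} {r : ℕ → ℝ} {p : ℕ → Euc n}

lemma le_integral_riesz_of_eq_bubbleSeries (hn : 3 ≤ n) (hr : ∀ j, 0 < r j)
    (hp : Tendsto p atTop (𝓝 0)) {α lam : ℝ} (hαn : α < n) (hlam : lam = (n - α) / (n - 2))
    {u : Euc n → ℝ} (hu0 : ∀ y, 0 ≤ u y) (hu : ∀ y ∈ ball (0 : Euc n) 3, u y = bubbleSeries r p y)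
    {x : Euc n} (hx : ‖x‖ < 2) (hint : Integrable fun y => ‖x - y‖ ^ (-α) * u y ^ lam)
    {ρ : ℝ} (hρ : 0 < ρ) (hρ1 : ρ ≤ 1) (j : ℕ)
    (h : ∀ y, ρ < ‖x - y‖ → ‖x - y‖ < 1 → r j ^ 2 + ‖y - p j‖ ^ 2 ≤ 68 * ‖x - y‖ ^ 2) :
    ((1 / 4 : ℝ) ^ j) ^ lam * 68 ^ (-(n - α) / 2) *
      (n * volume.real (ball (0 : Euc n) 1) * Real.log (1 / ρ)) ≤
      ∫ y, ‖x - y‖ ^ (-α) * u y ^ lam := by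
  have hn' : (3 : ℝ) ≤ n := by exact_mod_cast hn
  have : Nonempty (Fin n) := ⟨⟨0, by omega⟩⟩
  have hlam0 : 0 < lam := by rw [hlam]; exact div_pos (by linarith) (by linarith)
  refine le_integral_riesz (by omega) hρ hρ1 (by positivity) (fun y => Real.rpow_nonneg (hu0 y) _)
    hint ?_
  filter_upwards [compl_mem_ae_iff.2 (measure_singleton (0 : Euc n))] with y hy h1 h2
  have hy3 : y ∈ ball (0 : Euc n) 3 := by
    rw [mem_ball_zero_iff]
    calc ‖y‖ = ‖x - (x - y)‖ := by congr 1; abel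
      _ ≤ ‖x‖ + ‖x - y‖ := norm_sub_le _ _
      _ < 3 := by linarith
  have hxy : 0 < ‖x - y‖ := hρ.trans h1
  have hr2 : 0 < r j ^ 2 := pow_pos (hr j) 2
  rw [hu y hy3]
  calc _ = ((1 / 4 : ℝ) ^ j) ^ lam * (68 * ‖x - y‖ ^ 2) ^ (-(n - α) / 2) := by
        rw [Real.mul_rpow (by norm_num) (by positivity), ← Real.rpow_two, ← Real.rpow_mul hxy.le,
          mul_assoc]
        congr 3; ring
    _ ≤ ((1 / 4 : ℝ) ^ j) ^ lam * bubble (-(n - α) / 2) (r j ^ 2) (p j) y := by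
        gcongr
        exact Real.rpow_le_rpow_of_nonpos (by positivity) (h y h1 h2) (by linarith)
    _ = ((1 / 4 : ℝ) ^ j * bubble ((2 - n) / 2) (r j ^ 2) (p j) y) ^ lam := by
        rw [mul_bubble_rpow (by positivity) hr2, hlam]
        congr 2
        field_simp [show (n : ℝ) - 2 ≠ 0 by linarith]
        ring
    _ ≤ _ := Real.rpow_le_rpow (mul_nonneg (by positivity) (bubble_pos hr2 _ _).le)
        (le_bubbleSeries (by omega) hr hp hy j) hlam0.le

lemma neg_lap_bubbleSeries_le (hn : 3 ≤ n) (hr : ∀ j, 0 < r j) (hp : Tendsto p atTop (𝓝 0))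
    {σ I : ℝ} (hσ : σ = n / (n - 2)) {x : Euc n} (hx : x ≠ 0) (hI : 0 ≤ I)
    (h : ∀ j, n * (n - 2) * (r j ^ 2 / (r j ^ 2 + ‖x - p j‖ ^ 2)) ≤
      I * ((1 / 4 : ℝ) ^ j) ^ (σ - 1)) :
    -lap (bubbleSeries r p) x ≤ I * bubbleSeries r p x ^ σ := by
  have hn' : (3 : ℝ) ≤ n := by exact_mod_cast hn
  have hr2 (j : ℕ) : 0 < r j ^ 2 := pow_pos (hr j) 2
  have hσ1 : 1 ≤ σ := by rw [hσ, le_div_iff₀ (by linarith)]; linarith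
  obtain ⟨h1, h2⟩ := summable_rpow_and_tsum_rpow_le
    (fun j => mul_nonneg (by positivity) (bubble_pos (hr2 j) (p j) x).le)
    (summable_bubbleSeries (by omega) hr hp hx) hσ1
  have hlap := (contDiffAt_bubbleSeries (by omega) hr hp hx).2
  refine (hasSum_le (fun j => ?_) hlap (h1.hasSum.mul_left I)).trans
    (mul_le_mul_of_nonneg_left h2 hI)
  have hb := (bubble_pos (s := -(n : ℝ) / 2) (hr2 j) (p j) x).le
  have hε : ((1 / 4 : ℝ) ^ j) ^ σ = (1 / 4 : ℝ) ^ j * ((1 / 4 : ℝ) ^ j) ^ (σ - 1) := by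
    rw [Real.rpow_sub_one (by positivity)]
    field_simp
  have hs : (2 - n : ℝ) / 2 * σ = -(n : ℝ) / 2 := by
    rw [hσ]
    field_simp [show (n : ℝ) - 2 ≠ 0 by linarith]
    ring
  rw [mul_bubble_rpow (by positivity) (hr2 j), hε, hs]
  calc _ ≤ (1 / 4 : ℝ) ^ j * (I * ((1 / 4 : ℝ) ^ j) ^ (σ - 1) *
        bubble (-(n : ℝ) / 2) (r j ^ 2) (p j) x) := by
        exact mul_le_mul_of_nonneg_left (mul_le_mul_of_nonneg_right (h j) hb) (by positivity)
    _ = _ := by ring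

lemma neg_lap_bubbleSeries_nonneg (hn : 2 ≤ n) (hr : ∀ j, 0 < r j) (hp : Tendsto p atTop (𝓝 0))
    {x : Euc n} (hx : x ≠ 0) : 0 ≤ -lap (bubbleSeries r p) x := by
  have hn' : (2 : ℝ) ≤ n := by exact_mod_cast hn
  have hn2 : (0 : ℝ) ≤ n - 2 := by linarith
  refine (contDiffAt_bubbleSeries hn hr hp hx).2.nonneg fun j => ?_
  have := bubble_pos (s := -(n : ℝ) / 2) (pow_pos (hr j) 2) (p j) x
  positivity

lemma riesz_coefficient_bound (hn : 3 ≤ n) (hr : ∀ j, 0 < r j) (hr1 : ∀ j, r j ≤ 1)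
    (hp : Tendsto p atTop (𝓝 0)) (hp1 : ∀ j, ‖p j‖ ≤ 1) {α lam σ C : ℝ} (hαn : α < n)
    (hlam : lam = (n - α) / (n - 2))
    (hC : C = 68 ^ (-(n - α) / 2) * (n * volume.real (ball (0 : Euc n) 1)))
    (hnear : ∀ j, (n : ℝ) * (n - 2) ≤
      ((1 / 4 : ℝ) ^ j) ^ (σ - 1) * ((1 / 4 : ℝ) ^ j) ^ lam * C * Real.log (1 / √(r j)))
    (hfar : ∀ j, (n : ℝ) * (n - 2) * r j ≤ C * Real.log 2 * ((1 / 4 : ℝ) ^ j) ^ (σ - 1))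
    {u : Euc n → ℝ} (hu0 : ∀ y, 0 ≤ u y) (hu : ∀ y ∈ ball (0 : Euc n) 3, u y = bubbleSeries r p y)
    {x : Euc n} (hx : ‖x‖ < 2) (hint : Integrable fun y => ‖x - y‖ ^ (-α) * u y ^ lam) (j : ℕ) :
    n * (n - 2) * (r j ^ 2 / (r j ^ 2 + ‖x - p j‖ ^ 2)) ≤
      (∫ y, ‖x - y‖ ^ (-α) * u y ^ lam) * ((1 / 4 : ℝ) ^ j) ^ (σ - 1) := by
  have hn' : (3 : ℝ) ≤ n := by exact_mod_cast hn
  have hN : 0 ≤ (n : ℝ) * (n - 2) := mul_nonneg (by linarith) (by linarith)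
  have hrj := hr j
  have hsq : √(r j) ^ 2 = r j := Real.sq_sqrt hrj.le
  have hs0 : 0 < √(r j) := Real.sqrt_pos.2 hrj
  have hε : 0 < ((1 / 4 : ℝ) ^ j) ^ (σ - 1) := by positivity
  rcases le_or_gt ‖x - p j‖ √(r j) with hle | hgt
  · have key := le_integral_riesz_of_eq_bubbleSeries hn hr hp hαn hlam hu0 hu hx hint hs0
      (Real.sqrt_le_one.2 (hr1 j)) j fun y h1 _ => by
        have h2 : ‖y - p j‖ ≤ 2 * ‖x - y‖ := by
          calc ‖y - p j‖ = ‖(x - p j) - (x - y)‖ := by congr 1; abel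
            _ ≤ ‖x - p j‖ + ‖x - y‖ := norm_sub_le _ _
            _ ≤ _ := by linarith
        have h3 : r j ≤ ‖x - y‖ ^ 2 := hsq ▸ pow_le_pow_left₀ hs0.le h1.le 2
        have h4 : r j ^ 2 ≤ r j := by nlinarith [hr1 j]
        have h5 := pow_le_pow_left₀ (norm_nonneg _) h2 2
        nlinarith [sq_nonneg ‖x - y‖]
    calc _ ≤ (n : ℝ) * (n - 2) * 1 := by
          gcongr
          exact div_le_one_of_le₀ (by nlinarith [sq_nonneg ‖x - p j‖]) (by positivity)
      _ ≤ (((1 / 4 : ℝ) ^ j) ^ lam * 68 ^ (-(n - α) / 2) *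
          (n * volume.real (ball (0 : Euc n) 1) * Real.log (1 / √(r j)))) *
          ((1 / 4 : ℝ) ^ j) ^ (σ - 1) := by
        rw [mul_one]
        refine (hnear j).trans_eq ?_
        rw [hC]; ring
      _ ≤ _ := by gcongr
  · have key := le_integral_riesz_of_eq_bubbleSeries hn hr hp hαn hlam hu0 hu hx hint
      (ρ := 1 / 2) (by norm_num) (by norm_num) 0 fun y h1 h1' => by
        have h2 : ‖y - p 0‖ ≤ 4 := by
          calc ‖y - p 0‖ = ‖x - (x - y) - p 0‖ := by congr 1; abel
            _ ≤ ‖x - (x - y)‖ + ‖p 0‖ := norm_sub_le _ _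
            _ ≤ ‖x‖ + ‖x - y‖ + ‖p 0‖ := by gcongr; exact norm_sub_le _ _
            _ ≤ _ := by linarith [hp1 0]
        have h4 := pow_le_pow_left₀ (hr 0).le (hr1 0) 2
        have h5 := pow_le_pow_left₀ (norm_nonneg _) h2 2
        have h6 := pow_le_pow_left₀ (by norm_num) h1.le 2
        linarith
    calc _ ≤ (n : ℝ) * (n - 2) * r j := by
          gcongr
          have h7 := pow_le_pow_left₀ hs0.le hgt.le 2
          rw [hsq] at h7
          rw [div_le_iff₀ (by positivity)]
          nlinarith [pow_pos hrj 3]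
      _ ≤ (((1 / 4 : ℝ) ^ 0) ^ lam * 68 ^ (-(n - α) / 2) *
          (n * volume.real (ball (0 : Euc n) 1) * Real.log (1 / (1 / 2)))) *
          ((1 / 4 : ℝ) ^ j) ^ (σ - 1) := by
        refine (hfar j).trans_eq ?_
        rw [hC, pow_zero, Real.one_rpow, one_div_one_div]; ring
      _ ≤ _ := by gcongr

/-- A smooth cutoff equal to `1` on the ball of radius `3` and to `0` outside that of radius `4`. -/
noncomputable def cutoff (n : ℕ) : ContDiffBump (0 : Euc n) := ⟨3, 4, by norm_num, by norm_num⟩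

lemma isCPSolution_cutoff_mul (hn : 3 ≤ n) (hr : ∀ j, 0 < r j) (hr1 : ∀ j, r j ≤ 1)
    (hp : Tendsto p atTop (𝓝 0)) (hp1 : ∀ j, ‖p j‖ ≤ 1) {α lam σ C : ℝ} (hα0 : 0 < α) (hαn : α < n)
    (hlam : lam = (n - α) / (n - 2)) (hσ : σ = n / (n - 2))
    (hC : C = 68 ^ (-(n - α) / 2) * (n * volume.real (ball (0 : Euc n) 1)))
    (hnear : ∀ j, (n : ℝ) * (n - 2) ≤
      ((1 / 4 : ℝ) ^ j) ^ (σ - 1) * ((1 / 4 : ℝ) ^ j) ^ lam * C * Real.log (1 / √(r j)))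
    (hfar : ∀ j, (n : ℝ) * (n - 2) * r j ≤ C * Real.log 2 * ((1 / 4 : ℝ) ^ j) ^ (σ - 1)) :
    IsCPSolution n α lam σ fun x => cutoff n x * bubbleSeries r p x := by
  have hn' : (3 : ℝ) ≤ n := by exact_mod_cast hn
  have : Nonempty (Fin n) := ⟨⟨0, by omega⟩⟩
  have hlam0 : 0 < lam := by rw [hlam]; exact div_pos (by linarith) (by linarith)
  set u : Euc n → ℝ := fun x => cutoff n x * bubbleSeries r p x with hu_def
  have hu0 (x : Euc n) : 0 ≤ u x := mul_nonneg (cutoff n).nonneg (bubbleSeries_nonneg hr x)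
  have hu : ∀ y ∈ ball (0 : Euc n) 3, u y = bubbleSeries r p y := fun y hy => by
    rw [hu_def]
    simp only [(cutoff n).one_of_mem_closedBall (ball_subset_closedBall hy), one_mul]
  have hsmooth (x : Euc n) (hx : x ≠ 0) : ContDiffAt ℝ 2 u x :=
    (cutoff n).contDiffAt.mul (contDiffAt_bubbleSeries (by omega) hr hp hx).1
  have hmeas : AEStronglyMeasurable u :=
    (cutoff n).continuous.aestronglyMeasurable.mul
      (aestronglyMeasurable_bubbleSeries (by omega) hr hp)
  have hint : Integrable fun y => u y ^ lam := by
    have hF := (integrableOn_bubbleSeries_rpow hn hr hp hp1 (by linarith) (by linarith) hlam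
      4).integrable_indicator measurableSet_ball
    refine hF.mono' (hmeas.aemeasurable.pow_const _).aestronglyMeasurable
      (Eventually.of_forall fun y => ?_)
    rw [Real.norm_of_nonneg (Real.rpow_nonneg (hu0 y) _)]
    by_cases hy : y ∈ ball (0 : Euc n) 4
    · rw [indicator_of_mem hy]
      exact Real.rpow_le_rpow (hu0 y)
        (mul_le_of_le_one_left (bubbleSeries_nonneg hr y) (cutoff n).le_one) hlam0.le
    · have h0 : cutoff n y = 0 := (cutoff n).zero_of_le_dist (not_lt.1 hy)
      rw [indicator_of_notMem hy, hu_def]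
      simp only [h0, zero_mul]
      exact (Real.zero_rpow hlam0.ne').le
  refine ⟨hu0, fun x hx => (hsmooth x hx).contDiffWithinAt, hint, fun x hx => ?_⟩
  have hx0 : x ≠ 0 := hx.2
  have hx2 : ‖x‖ < 2 := mem_ball_zero_iff.1 hx.1
  have hx3 : x ∈ ball (0 : Euc n) 3 := mem_ball_zero_iff.2 (by linarith)
  have hev : u =ᶠ[𝓝 x] bubbleSeries r p :=
    Filter.eventuallyEq_of_mem (isOpen_ball.mem_nhds hx3) hu
  have hlap : lap u x = lap (bubbleSeries r p) x := by
    unfold lap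
    rw [(hev.iteratedFDeriv ℝ 2).self_of_nhds]
  rw [hlap, hu x hx3]
  refine ⟨neg_lap_bubbleSeries_nonneg (by omega) hr hp hx0,
    neg_lap_bubbleSeries_le hn hr hp hσ hx0 ?_ ?_⟩
  · exact integral_nonneg fun y => mul_nonneg (by positivity) (Real.rpow_nonneg (hu0 y) _)
  · exact riesz_coefficient_bound hn hr hr1 hp hp1 hαn hlam hC hnear hfar hu0 hu hx2
      (integrable_riesz (by omega) hα0 hαn (fun y => Real.rpow_nonneg (hu0 y) _) hint
        ((hsmooth x hx0).continuousAt.rpow_const (Or.inr hlam0.le)))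

end Construction

theorem stmt3 (n : ℕ) (hn : 3 ≤ n) (α lam sig : ℝ)
    (hα0 : 0 < α) (hαn : α < n)
    (hlam : lam = ((n : ℝ) - α) / ((n : ℝ) - 2))
    (hsig : sig = (n : ℝ) / ((n : ℝ) - 2))
    (φ : ℝ → ℝ) (hφc : ContinuousOn φ (Ioo 0 1))
    (hφp : ∀ t ∈ Ioo (0:ℝ) 1, 0 < φ t)
    (hφl : Tendsto φ (𝓝[>] (0:ℝ)) atTop) :
    ∃ u : Euc n → ℝ, IsCPSolution n α lam sig u ∧ NotBigOAt n u φ := by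
  have hn' : (3 : ℝ) ≤ n := by exact_mod_cast hn
  have : Nonempty (Fin n) := ⟨⟨0, by omega⟩⟩
  let p (j : ℕ) : Euc n := EuclideanSpace.single ⟨0, by omega⟩ ((1 / 2 : ℝ) ^ (j + 1))
  have hnorm (j : ℕ) : ‖p j‖ = (1 / 2 : ℝ) ^ (j + 1) := by
    rw [PiLp.norm_single, Real.norm_of_nonneg (by positivity)]
  have hpI (j : ℕ) : ‖p j‖ ∈ Ioo (0 : ℝ) 1 := by
    rw [hnorm]
    exact ⟨by positivity, pow_lt_one₀ (by norm_num) (by norm_num) (by omega)⟩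
  have hp0 (j : ℕ) : p j ≠ 0 := norm_pos_iff.1 (hpI j).1
  have hp : Tendsto p atTop (𝓝 0) := by
    rw [tendsto_zero_iff_norm_tendsto_zero]
    simp only [hnorm]
    exact (tendsto_pow_atTop_nhds_zero_of_lt_one (by norm_num) (by norm_num)).comp
      (tendsto_add_atTop_nat 1)
  obtain ⟨C, hC⟩ : ∃ C, C = 68 ^ (-(n - α) / 2) * (n * volume.real (ball (0 : Euc n) 1)) :=
    ⟨_, rfl⟩
  have hC0 : 0 < C := by
    have hvol : 0 < volume.real (ball (0 : Euc n) 1) :=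
      ENNReal.toReal_pos (measure_ball_pos _ _ one_pos).ne' measure_ball_lt_top.ne
    have : (0 : ℝ) < n := by linarith
    rw [hC]; positivity
  have hlog : 0 < Real.log 2 := Real.log_pos one_lt_two
  choose r hr hr1 hφr hnear hfar using fun j : ℕ =>
    exists_scale (s := (2 - n : ℝ) / 2) (ε := (1 / 4 : ℝ) ^ j)
      (A := ((1 / 4 : ℝ) ^ j) ^ (sig - 1) * ((1 / 4 : ℝ) ^ j) ^ lam * C)
      (B := C * Real.log 2 * ((1 / 4 : ℝ) ^ j) ^ (sig - 1))
      (j * φ ‖p j‖) (n * (n - 2)) (by linarith) (by positivity) (by positivity) (by positivity)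
  refine ⟨_, isCPSolution_cutoff_mul hn hr hr1 hp (fun j => (hpI j).2.le) hα0 hαn hlam hsig hC
    hnear hfar, p, hp0, hp, tendsto_atTop_mono (fun j => ?_) tendsto_natCast_atTop_atTop⟩
  have hmem : p j ∈ closedBall (0 : Euc n) (cutoff n).rIn :=
    mem_closedBall_zero_iff.2 ((hpI j).2.le.trans (by norm_num [cutoff]))
  beta_reduce
  rw [(cutoff n).one_of_mem_closedBall hmem, one_mul, le_div_iff₀ (hφp _ (hpI j))]
  refine (hφr j).trans (le_trans (le_of_eq ?_) (le_bubbleSeries (by omega) hr hp (hp0 j) j))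
  simp [bubble]
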